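/- ∫_0^1 x (arctan x)/(1+x²) dx = G/2 − (π/8) ln 2, where G is Catalan's constant. -/

import Mathlib

open Real

/-- Catalan's constant `G = ∑_{k=0}^∞ (-1)^k / (2k+1)^2`. -/
noncomputable def catalanG : ℝ := ∑' k : ℕ, (-1 : ℝ) ^ k / (2 * (k : ℝ) + 1) ^ 2

/-- The logarithmic moments `∫₀¹ xⁿ log x dx = -1/(n+1)²`. -/
theorem integral_pow_mul_log_zero_one (n : ℕ) :
    ∫ x in (0 : ℝ)..1, x ^ n * log x = -(1 / ((n : ℝ) + 1) ^ 2) := by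
  have hn : (n : ℝ) + 1 ≠ 0 := by positivity
  have hc : Continuous fun x : ℝ =>
      x ^ n * (x * log x) / (n + 1) - x ^ (n + 1) / ((n : ℝ) + 1) ^ 2 := by
    have := Real.continuous_mul_log
    fun_prop
  rw [intervalIntegral.integral_eq_sub_of_hasDerivAt_of_le zero_le_one hc.continuousOn
    (fun x hx => ?_)
    (intervalIntegral.intervalIntegrable_log'.continuousOn_mul (by fun_prop))]
  · simp
  · have hx0 : x ≠ 0 := hx.1.ne'
    have h := (((hasDerivAt_pow (n + 1) x).fun_mul (hasDerivAt_log hx0)).div_const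
      ((n : ℝ) + 1)).fun_sub ((hasDerivAt_pow (n + 1) x).div_const (((n : ℝ) + 1) ^ 2))
    refine (h.congr_deriv ?_).congr_of_eventuallyEq (.of_forall fun y => by ring)
    push_cast
    field_simp
    ring

theorem summable_one_div_odd_sq : Summable fun k : ℕ => 1 / (2 * (k : ℝ) + 1) ^ 2 := by
  have h := (Real.summable_one_div_nat_pow (p := 2)).2 one_lt_two
  have h2 := h.comp_injective (i := fun k : ℕ => 2 * k + 1) (fun a b h => by simpa using h)
  simpa [Function.comp_def] using h2

theorem integral_log_div_one_add_sq :
    ∫ x in (0 : ℝ)..1, log x / (1 + x ^ 2) = -catalanG := by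
  have hint (k : ℕ) : IntervalIntegrable (fun x : ℝ => x ^ (2 * k) * log x)
      MeasureTheory.volume 0 1 :=
    intervalIntegral.intervalIntegrable_log'.continuousOn_mul (by fun_prop)
  have hnorm (k : ℕ) : ∫ x in Set.Ioo (0 : ℝ) 1, ‖(-1 : ℝ) ^ k * (x ^ (2 * k) * log x)‖ =
      1 / (2 * (k : ℝ) + 1) ^ 2 := by
    have h := integral_pow_mul_log_zero_one (2 * k)
    rw [intervalIntegral.integral_of_le zero_le_one,
      MeasureTheory.integral_Ioc_eq_integral_Ioo] at h
    have h' : ∫ x in Set.Ioo (0 : ℝ) 1, ‖(-1 : ℝ) ^ k * (x ^ (2 * k) * log x)‖ =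
        ∫ x in Set.Ioo (0 : ℝ) 1, -(x ^ (2 * k) * log x) := by
      refine MeasureTheory.setIntegral_congr_fun measurableSet_Ioo fun x hx => ?_
      have : x ^ (2 * k) * log x ≤ 0 :=
        mul_nonpos_of_nonneg_of_nonpos (pow_nonneg hx.1.le _) (log_nonpos hx.1.le hx.2.le)
      rw [norm_mul, norm_pow, norm_neg, norm_one, one_pow, one_mul, Real.norm_of_nonpos this]
    rw [h', MeasureTheory.integral_neg, h]
    push_cast
    ring
  have hs := MeasureTheory.hasSum_integral_of_summable_integral_norm
    (μ := MeasureTheory.volume.restrict (Set.Ioo (0 : ℝ) 1))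
    (F := fun (k : ℕ) (x : ℝ) => (-1 : ℝ) ^ k * (x ^ (2 * k) * log x))
    (fun k => (((intervalIntegrable_iff_integrableOn_Ioo_of_le zero_le_one).1
      (hint k)).const_mul ((-1 : ℝ) ^ k)))
    (by simpa only [hnorm] using summable_one_div_odd_sq)
  rw [intervalIntegral.integral_of_le zero_le_one, MeasureTheory.integral_Ioc_eq_integral_Ioo,
    catalanG, ← tsum_neg]
  have hsum : ∫ x in Set.Ioo (0 : ℝ) 1, log x / (1 + x ^ 2) =
      ∫ x in Set.Ioo (0 : ℝ) 1, ∑' k : ℕ, (-1 : ℝ) ^ k * (x ^ (2 * k) * log x) := by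
    refine MeasureTheory.setIntegral_congr_fun measurableSet_Ioo fun x hx => ?_
    have hr : ‖-x ^ 2‖ < 1 := by
      rw [norm_neg, Real.norm_of_nonneg (sq_nonneg x)]
      nlinarith [hx.1, hx.2]
    have hg := (hasSum_geometric_of_norm_lt_one hr).mul_right (log x)
    rw [sub_neg_eq_add] at hg
    rw [div_eq_inv_mul, ← hg.tsum_eq]
    refine tsum_congr fun k => ?_
    rw [neg_pow, pow_mul]
    ring
  rw [hsum, ← hs.tsum_eq]
  refine tsum_congr fun k => ?_
  have h := integral_pow_mul_log_zero_one (2 * k)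
  rw [intervalIntegral.integral_of_le zero_le_one,
    MeasureTheory.integral_Ioc_eq_integral_Ioo] at h
  rw [MeasureTheory.integral_const_mul, h]
  push_cast
  ring

theorem integral_log_sin_sub_log_cos :
    ∫ θ in (0 : ℝ)..(π / 4), (log (sin θ) - log (cos θ)) = -catalanG := by
  have hlog (x : ℝ) (hx : 0 ≤ x) : log (sin (arctan x)) - log (cos (arctan x)) = log x := by
    rcases hx.eq_or_lt with rfl | hx
    · simp
    · have hc := cos_arctan_pos x
      have hsin : sin (arctan x) = x * cos (arctan x) := by
        rw [← div_eq_iff hc.ne', ← tan_eq_sin_div_cos, tan_arctan]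
      rw [hsin, log_mul hx.ne' hc.ne']
      ring
  have hcongr : Set.EqOn (fun x : ℝ => log x / (1 + x ^ 2))
      (fun x => ((fun θ => log (sin θ) - log (cos θ)) ∘ arctan) x * (1 / (1 + x ^ 2)))
      (Set.uIcc 0 1) := by
    intro x hx
    rw [Set.uIcc_of_le zero_le_one] at hx
    simp only [Function.comp_apply, hlog x hx.1]
    ring
  have hpi := pi_pos
  have key := intervalIntegral.integral_comp_mul_deriv''' (a := 0) (b := 1) (f := arctan)
    (f' := fun x => 1 / (1 + x ^ 2)) (g := fun θ => log (sin θ) - log (cos θ))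
    continuous_arctan.continuousOn (fun x _ => (hasDerivAt_arctan x).hasDerivWithinAt)
    ?_ ?_ ?_
  · rw [arctan_zero, arctan_one] at key
    rw [← key, ← integral_log_div_one_add_sq]
    exact (intervalIntegral.integral_congr hcongr).symm
  · rintro _ ⟨x, hx, rfl⟩
    rw [min_eq_left zero_le_one, max_eq_right zero_le_one] at hx
    have h1 := cos_arctan_pos x
    have h2 : 0 < sin (arctan x) := sin_pos_of_pos_of_lt_pi (arctan_pos.2 hx.1)
      (by linarith [arctan_lt_pi_div_two x])
    exact ((continuous_sin.continuousAt.log h2.ne').sub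
      (continuous_cos.continuousAt.log h1.ne')).continuousWithinAt
  · have h : IntervalIntegrable (fun θ => log (sin θ) - log (cos θ))
        MeasureTheory.volume 0 (π / 4) :=
      intervalIntegrable_log_sin.sub intervalIntegrable_log_cos
    rw [intervalIntegrable_iff', Set.uIcc_of_le (by positivity)] at h
    refine h.mono_set ?_
    rintro _ ⟨x, hx, rfl⟩
    rw [Set.uIcc_of_le zero_le_one] at hx
    exact ⟨arctan_nonneg.2 hx.1, arctan_one ▸ arctan_mono hx.2⟩
  · have h : IntervalIntegrable (fun x : ℝ => log x * (1 + x ^ 2)⁻¹)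
        MeasureTheory.volume 0 1 := by
      refine intervalIntegral.intervalIntegrable_log'.mul_continuousOn ?_
      exact (Continuous.inv₀ (by fun_prop) fun x => by positivity).continuousOn
    rw [intervalIntegrable_iff'] at h
    refine h.congr_fun (fun x hx => ?_) measurableSet_uIcc
    simpa only [div_eq_mul_inv] using hcongr hx

theorem integral_log_cos_zero_pi_div_four :
    ∫ θ in (0 : ℝ)..(π / 4), log (cos θ) = catalanG / 2 - π / 4 * log 2 := by
  have hsin (a b : ℝ) : IntervalIntegrable (fun θ => log (sin θ)) MeasureTheory.volume a b :=
    intervalIntegrable_log_sin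
  have hcos (a b : ℝ) : IntervalIntegrable (fun θ => log (cos θ)) MeasureTheory.volume a b :=
    intervalIntegrable_log_cos
  have hdiff := integral_log_sin_sub_log_cos
  rw [intervalIntegral.integral_sub (hsin _ _) (hcos _ _)] at hdiff
  have hadd := intervalIntegral.integral_add_adjacent_intervals (hsin 0 (π / 4))
    (hsin (π / 4) (π / 2))
  have hrefl := intervalIntegral.integral_comp_sub_left (a := 0) (b := π / 4)
    (fun θ => log (sin θ)) (π / 2)
  simp only [sin_pi_div_two_sub, sub_zero] at hrefl
  rw [show π / 2 - π / 4 = π / 4 by ring] at hrefl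
  rw [integral_log_sin_zero_pi_div_two, ← hrefl] at hadd
  linarith

theorem integral_mul_tan_zero_pi_div_four :
    ∫ θ in (0 : ℝ)..(π / 4), θ * tan θ = catalanG / 2 - π / 8 * log 2 := by
  have hpi := pi_pos
  have hpos (θ : ℝ) (hθ : θ ∈ Set.uIcc 0 (π / 4)) : 0 < cos θ := by
    rw [Set.uIcc_of_le (by positivity)] at hθ
    exact cos_pos_of_mem_Ioo ⟨by linarith [hθ.1], by linarith [hθ.2]⟩
  have htan : IntervalIntegrable (fun θ => θ * tan θ) MeasureTheory.volume 0 (π / 4) :=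
    ContinuousOn.intervalIntegrable fun θ hθ =>
      (continuousAt_id.mul (continuousAt_tan.2 (hpos θ hθ).ne')).continuousWithinAt
  have hcos : IntervalIntegrable (fun θ => log (cos θ)) MeasureTheory.volume 0 (π / 4) :=
    intervalIntegrable_log_cos
  have hderiv (θ : ℝ) (hθ : θ ∈ Set.uIcc 0 (π / 4)) :
      HasDerivAt (fun θ => -(θ * log (cos θ))) (θ * tan θ - log (cos θ)) θ := by
    refine ((hasDerivAt_id θ).mul
      ((hasDerivAt_cos θ).log (hpos θ hθ).ne')).neg.congr_deriv ?_
    rw [tan_eq_sin_div_cos, id]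
    ring
  have h := intervalIntegral.integral_eq_sub_of_hasDerivAt hderiv (htan.sub hcos)
  rw [intervalIntegral.integral_sub htan hcos, integral_log_cos_zero_pi_div_four,
    cos_pi_div_four, log_div (by positivity) two_ne_zero, log_sqrt zero_le_two] at h
  linarith

theorem stmt_11 :
    ∫ x in (0 : ℝ)..1, x * Real.arctan x / (1 + x ^ 2) =
      catalanG / 2 - π / 8 * Real.log 2 := by
  have key := intervalIntegral.integral_comp_mul_deriv'' (a := 0) (b := 1) (f := arctan)
    (f' := fun x => 1 / (1 + x ^ 2)) (g := fun θ => θ * tan θ)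
    continuous_arctan.continuousOn (fun x _ => (hasDerivAt_arctan x).hasDerivWithinAt)
    (Continuous.div continuous_const (by fun_prop) fun x => by positivity).continuousOn ?_
  · rw [arctan_zero, arctan_one, integral_mul_tan_zero_pi_div_four] at key
    rw [← key]
    congr 1
    ext x
    simp only [Function.comp_apply, tan_arctan]
    ring
  · rintro _ ⟨x, -, rfl⟩
    exact (continuousAt_id.mul
      (continuousAt_tan.2 (cos_arctan_pos x).ne')).continuousWithinAt
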